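/- arXiv:2402.01820 — 2 statements merged into one kernel-verified Lean document; each statement's English description precedes it below -/
import Mathlib

section
/- Let ℓ ∈ T((ℝ^d)) be supported on single-letter words, i.e. ℓ = Σ_{i=1}^d ℓ^i e_i with ℓ^i ∈ ℝ. Then the shuffle exponential satisfies exp_⧢(ℓ) = 𝟙 + exp_⧢(ℓ) ⊗ ℓ = 𝟙 + ℓ ⊗ exp_⧢(ℓ), where ⊗ is the concatenation product. -/
/-- Words over the alphabet `{1, …, d}`, modeled as lists over `Fin d`. -/
abbrev Word (d : ℕ) := List (Fin d)

/-- The extended tensor algebra `T((ℝ^d))`, modeled as real-valued functions on words. -/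
abbrev Tensor (d : ℕ) := Word d → ℝ

namespace Sig

/-- The unit `𝟙`: the indicator of the empty word. -/
def unit (d : ℕ) : Tensor d := fun w => if w = [] then 1 else 0

/-- The concatenation product `(ℓ ⊗ p)(w) = Σ_{w = u·v} ℓ(u) p(v)`. -/
def concatProd {d : ℕ} (l p : Tensor d) : Tensor d :=
  fun w => ∑ i ∈ Finset.range (w.length + 1), l (w.take i) * p (w.drop i)

/-- `n`-fold concatenation power, `ℓ^⊗0 = 𝟙`. -/
def concatPow {d : ℕ} (l : Tensor d) : ℕ → Tensor d
  | 0 => unit d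
  | n + 1 => concatProd (concatPow l n) l

/-- The letter `e_i`: the indicator of the one-letter word `i`. -/
def letter {d : ℕ} (i : Fin d) : Tensor d := fun w => if w = [i] then 1 else 0

/-- The shuffle product on `T((ℝ^d))`, the coefficientwise bilinear extension of the
inductive shuffle of words. -/
def shuffle {d : ℕ} : Tensor d → Tensor d → Word d → ℝ
  | l, m, [] => l [] * m []
  | l, m, i :: w => shuffle (fun u => l (i :: u)) m w + shuffle l (fun u => m (i :: u)) w

/-- `n`-fold shuffle power, `ℓ^⧢0 = 𝟙`. -/
def shufflePow {d : ℕ} (l : Tensor d) : ℕ → Tensor d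
  | 0 => unit d
  | n + 1 => shuffle (shufflePow l n) l

/-- The resolvent `(𝟙 − q)^{-1} = Σ_{n≥0} q^⊗n`, defined coefficientwise. -/
noncomputable def resolvent {d : ℕ} (q : Tensor d) : Tensor d :=
  fun w => ∑' n : ℕ, concatPow q n w

/-- The shuffle exponential `exp_⧢(ℓ) = Σ_{n≥0} ℓ^⧢n / n!`, defined coefficientwise. -/
noncomputable def shuffleExp {d : ℕ} (l : Tensor d) : Tensor d :=
  fun w => ∑' n : ℕ, shufflePow l n w / (n.factorial : ℝ)

/-- Right-deconcatenation (projection) by a word `u`: `(ℓ π_u)(w) = ℓ(w·u)`. -/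
def proj {d : ℕ} (l : Tensor d) (u : Word d) : Tensor d := fun w => l (w ++ u)

theorem shuffle_zero_left {d : ℕ} (m : Tensor d) (w : Word d) :
    shuffle (fun _ => 0) m w = 0 := by
  induction w generalizing m with
  | nil => simp [shuffle]
  | cons i w ih => simp [shuffle, ih]

theorem shuffle_zero_right {d : ℕ} (m : Tensor d) (w : Word d) :
    shuffle m (fun _ => 0) w = 0 := by
  induction w generalizing m with
  | nil => simp [shuffle]
  | cons i w ih => simp [shuffle, ih]

theorem shuffle_unit_right {d : ℕ} (m : Tensor d) (a : ℝ) (w : Word d) :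
    shuffle m (fun u => if u = [] then a else 0) w = a * m w := by
  induction w generalizing m with
  | nil => simp [shuffle, mul_comm]
  | cons i w ih => simp [shuffle, ih, shuffle_zero_right]

/-- The tensor supported on single letters with coefficients `c`. -/
def lin {d : ℕ} (c : Fin d → ℝ) : Tensor d
  | [i] => c i
  | _ => 0

theorem lin_cons {d : ℕ} (c : Fin d → ℝ) (i : Fin d) (u : Word d) :
    lin c (i :: u) = if u = [] then c i else 0 := by
  cases u <;> simp [lin]

theorem sum_eq_lin {d : ℕ} (c : Fin d → ℝ) : ∑ i : Fin d, c i • letter i = lin c := by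
  funext w
  rcases w with _ | ⟨i, _ | ⟨j, u⟩⟩ <;> simp [lin, letter, Finset.sum_apply]

theorem shuffle_homog {d : ℕ} (c : Fin d → ℝ) (n : ℕ) (K : ℝ) (w : Word d) :
    shuffle (fun u => if u.length = n then K * (u.map c).prod else 0) (lin c) w
      = if w.length = n + 1 then (n + 1) * K * (w.map c).prod else 0 := by
  induction w generalizing n K with
  | nil => simp [shuffle, lin]
  | cons i w ih =>
    simp only [shuffle, lin_cons, shuffle_unit_right]
    cases n with
    | zero =>
      simp only [List.length_cons, Nat.add_eq_zero_iff, one_ne_zero, and_false, if_false,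
        shuffle_zero_left]
      by_cases h : w.length = 0 <;> simp [h]
      ring
    | succ m =>
      have := ih m (K * c i)
      simp only [List.length_cons, List.map_cons, List.prod_cons, add_left_inj, ← mul_assoc]
        at this ⊢
      rw [this]
      split_ifs
      · push_cast; ring
      · simp

theorem shufflePow_lin {d : ℕ} (c : Fin d → ℝ) (n : ℕ) :
    shufflePow (lin c) n
      = fun w => if w.length = n then (n.factorial : ℝ) * (w.map c).prod else 0 := by
  induction n with
  | zero =>
    funext w
    cases w <;> simp [shufflePow, unit]
  | succ n ih =>
    funext w
    rw [shufflePow, ih, shuffle_homog, Nat.factorial_succ]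
    push_cast
    rfl

theorem shuffleExp_lin {d : ℕ} (c : Fin d → ℝ) (w : Word d) :
    shuffleExp (lin c) w = (w.map c).prod := by
  rw [shuffleExp, tsum_eq_single w.length]
  · have := Nat.factorial_ne_zero w.length
    rw [shufflePow_lin]
    simp only [if_true]
    field_simp
  · intro n hn
    simp [shufflePow_lin, hn.symm]

/-- for `ℓ` supported on single-letter words,
`exp_⧢(ℓ) = 𝟙 + exp_⧢(ℓ) ⊗ ℓ = 𝟙 + ℓ ⊗ exp_⧢(ℓ)`. -/
theorem shuffleExp_fixed_point {d : ℕ} (hd : 1 ≤ d) (l : Tensor d) (c : Fin d → ℝ)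
    (hl : l = ∑ i : Fin d, c i • letter i) :
    shuffleExp l = unit d + concatProd (shuffleExp l) l ∧
    shuffleExp l = unit d + concatProd l (shuffleExp l) := by
  rw [sum_eq_lin] at hl
  subst hl
  constructor
  · funext w
    rcases List.eq_nil_or_concat w with rfl | ⟨u, a, rfl⟩
    · simp [concatProd, shuffleExp_lin, unit, lin]
    · simp only [List.concat_eq_append, Pi.add_apply, concatProd, shuffleExp_lin]
      rw [Finset.sum_eq_single u.length]
      · simp [unit, lin]
      · intro b hb hne
        have hb' : b ≤ u.length + 1 := by simpa using hb
        have : lin c ((u ++ [a]).drop b) = 0 := by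
          have hlen : ((u ++ [a]).drop b).length ≠ 1 := by
            simp only [List.length_drop, List.length_append, List.length_singleton]
            omega
          generalize (u ++ [a]).drop b = v at hlen
          rcases v with _ | ⟨i, _ | ⟨j, v⟩⟩ <;> simp_all [lin]
        rw [this, mul_zero]
      · intro h
        simp at h
  · funext w
    rcases w with _ | ⟨a, u⟩
    · simp [concatProd, shuffleExp_lin, unit, lin]
    · simp only [Pi.add_apply, concatProd, shuffleExp_lin]
      rw [Finset.sum_eq_single 1]
      · simp [unit, lin]
      · intro b hb hne
        have hb' : b ≤ u.length + 1 := by simpa using hb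
        have : lin c ((a :: u).take b) = 0 := by
          have hlen : ((a :: u).take b).length ≠ 1 := by
            simp only [List.length_take, List.length_cons]
            omega
          generalize (a :: u).take b = v at hlen
          rcases v with _ | ⟨i, _ | ⟨j, v⟩⟩ <;> simp_all [lin]
        rw [this, zero_mul]
      · intro h
        simp at h

end Sig
end

section
/- Let ℓ ∈ T((ℝ^d)), let i ∈ {1,…,d} be a letter, and let b = Σ_{j=1}^d b^j e_j ∈ T((ℝ^d)) be supported on single-letter words. Then (ℓ ⊗ e_i) ⊗ exp_⧢(b) = exp_⧢(b) ⧢ ((exp_⧢(−b) ⧢ ℓ) ⊗ e_i). -/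
namespace Sig

theorem shuffle_add_left {d : ℕ} (l l' m : Tensor d) (w : Word d) :
    shuffle (fun u => l u + l' u) m w = shuffle l m w + shuffle l' m w := by
  induction w generalizing l l' m with
  | nil => simp only [shuffle]; ring
  | cons j w ih => simp only [shuffle, ih]; ring

theorem shuffle_add_right {d : ℕ} (l m m' : Tensor d) (w : Word d) :
    shuffle l (fun u => m u + m' u) w = shuffle l m w + shuffle l m' w := by
  induction w generalizing l m m' with
  | nil => simp only [shuffle]; ring
  | cons j w ih => simp only [shuffle, ih]; ring

theorem shuffle_smul_left {d : ℕ} (a : ℝ) (l m : Tensor d) (w : Word d) :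
    shuffle (fun u => a * l u) m w = a * shuffle l m w := by
  induction w generalizing l m with
  | nil => simp only [shuffle]; ring
  | cons j w ih => simp only [shuffle, ih]; ring

theorem shuffle_smul_right {d : ℕ} (a : ℝ) (l m : Tensor d) (w : Word d) :
    shuffle l (fun u => a * m u) w = a * shuffle l m w := by
  induction w generalizing l m with
  | nil => simp only [shuffle]; ring
  | cons j w ih => simp only [shuffle, ih]; ring

theorem unit_cons {d : ℕ} (j : Fin d) : (fun u => unit d (j :: u)) = fun _ => 0 := by
  funext u; simp [unit]

theorem shuffle_unit_right_s7 {d : ℕ} (l : Tensor d) (w : Word d) :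
    shuffle l (unit d) w = l w := by
  induction w generalizing l with
  | nil => simp [shuffle, unit]
  | cons j w ih => simp only [shuffle, ih, unit_cons, shuffle_zero_right, add_zero]

/-- The multiplicative function on words. -/
def mulExp {d : ℕ} (c : Fin d → ℝ) : Tensor d := fun w => (w.map c).prod

/-- The homogeneous part of `mulExp`. -/
def mulPart {d : ℕ} (c : Fin d → ℝ) (n : ℕ) : Tensor d :=
  fun w => if w.length = n then (w.map c).prod else 0

theorem mulPart_succ_cons {d : ℕ} (c : Fin d → ℝ) (n : ℕ) (j : Fin d) :
    (fun u => mulPart c (n + 1) (j :: u)) = fun u => c j * mulPart c n u := by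
  funext u; simp [mulPart]

theorem mulPart_zero_cons {d : ℕ} (c : Fin d → ℝ) (j : Fin d) :
    (fun u => mulPart c 0 (j :: u)) = fun _ => 0 := by
  funext u; simp [mulPart]

theorem mulPart_zero {d : ℕ} (c : Fin d → ℝ) : mulPart c 0 = unit d := by
  funext u; cases u <;> simp [mulPart, unit]

theorem mulPart_one_cons {d : ℕ} (c : Fin d → ℝ) (j : Fin d) :
    (fun u => mulPart c 1 (j :: u)) = fun u => c j * unit d u := by
  rw [mulPart_succ_cons, mulPart_zero]

theorem shuffle_mulPart {d : ℕ} (c : Fin d → ℝ) (n : ℕ) (w : Word d) :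
    shuffle (mulPart c n) (mulPart c 1) w = (n + 1) * mulPart c (n + 1) w := by
  induction w generalizing n with
  | nil => simp [shuffle, mulPart]
  | cons j w ih =>
    have h := congrFun (mulPart_succ_cons c n j) w
    rw [h]
    simp only [shuffle]
    rw [mulPart_one_cons, shuffle_smul_right, shuffle_unit_right_s7]
    cases n with
    | zero => rw [mulPart_zero_cons, shuffle_zero_left]; simp
    | succ n => rw [mulPart_succ_cons, shuffle_smul_left, ih]; push_cast; ring

theorem shufflePow_mulPart {d : ℕ} (c : Fin d → ℝ) (n : ℕ) :
    shufflePow (mulPart c 1) n = fun w => (n.factorial : ℝ) * mulPart c n w := by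
  induction n with
  | zero => simp [shufflePow, mulPart_zero]
  | succ n ih =>
    funext w
    rw [shufflePow, ih, shuffle_smul_left, shuffle_mulPart, Nat.factorial_succ]
    push_cast; ring

theorem shuffleExp_mulPart {d : ℕ} (c : Fin d → ℝ) : shuffleExp (mulPart c 1) = mulExp c := by
  funext w
  simp only [shuffleExp, shufflePow_mulPart]
  rw [tsum_eq_single w.length]
  · simp [mulPart, mulExp, Nat.factorial_ne_zero]
  · intro n hn
    simp [mulPart, hn.symm]

theorem sum_letter {d : ℕ} (c : Fin d → ℝ) : ∑ j : Fin d, c j • letter j = mulPart c 1 := by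
  funext w
  rcases w with _ | ⟨a, _ | ⟨a', w⟩⟩ <;> simp [Finset.sum_apply, letter, mulPart]

theorem neg_mulPart {d : ℕ} (c : Fin d → ℝ) : -mulPart c 1 = mulPart (fun j => -c j) 1 := by
  funext w
  rcases w with _ | ⟨a, _ | ⟨a', w⟩⟩ <;> simp [mulPart]

theorem concatProd_cons {d : ℕ} (l p : Tensor d) (j : Fin d) (w : Word d) :
    concatProd l p (j :: w) = concatProd (fun u => l (j :: u)) p w + l [] * p (j :: w) := by
  simp [concatProd, Finset.sum_range_succ' _ (w.length + 1)]

theorem concatProd_add_left {d : ℕ} (l l' p : Tensor d) (w : Word d) :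
    concatProd (fun u => l u + l' u) p w = concatProd l p w + concatProd l' p w := by
  simp [concatProd, add_mul, Finset.sum_add_distrib]

theorem concatProd_smul_left {d : ℕ} (a : ℝ) (l p : Tensor d) (w : Word d) :
    concatProd (fun u => a * l u) p w = a * concatProd l p w := by
  simp [concatProd, Finset.mul_sum, mul_assoc]

theorem concatProd_unit_left {d : ℕ} (p : Tensor d) (w : Word d) :
    concatProd (unit d) p w = p w := by
  cases w with
  | nil => simp [concatProd, unit]
  | cons j w =>
    rw [concatProd_cons, unit_cons]
    simp [concatProd, unit]

theorem concat_letter_cons {d : ℕ} (l : Tensor d) (i j : Fin d) (w : Word d) :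
    concatProd l (letter i) (j :: w) = concatProd (fun u => l (j :: u)) (letter i) w +
      (l [] * if j = i then 1 else 0) * unit d w := by
  rw [concatProd_cons]
  by_cases h : j = i <;> cases w <;> simp [letter, unit, h]

theorem mulExp_cons {d : ℕ} (c : Fin d → ℝ) (j : Fin d) (u : Word d) :
    mulExp c (j :: u) = c j * mulExp c u := by
  simp [mulExp]

theorem main_aux {d : ℕ} (l : Tensor d) (i : Fin d) (c : Fin d → ℝ) (w : Word d) :
    concatProd (concatProd l (letter i)) (mulExp c) w =
      shuffle (mulExp c) (concatProd (shuffle (mulExp (fun j => -c j)) l) (letter i)) w := by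
  induction w generalizing l with
  | nil => simp [concatProd, shuffle, letter]
  | cons j w ih =>
    have h0 : concatProd l (letter i) [] = 0 := by simp [concatProd, letter]
    rw [concatProd_cons, h0, zero_mul, add_zero]
    simp only [concat_letter_cons, shuffle, mulExp_cons]
    rw [concatProd_add_left, concatProd_smul_left, concatProd_unit_left, ih]
    simp only [shuffle_smul_left, concatProd_add_left, concatProd_smul_left, shuffle_add_right,
      shuffle_smul_right, shuffle_unit_right_s7]
    simp only [mulExp, List.map_nil, List.prod_nil]
    ring

/-- for any `ℓ`, letter `i`, and `b` supported on single-letter words,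
`(ℓ ⊗ e_i) ⊗ exp_⧢(b) = exp_⧢(b) ⧢ ((exp_⧢(−b) ⧢ ℓ) ⊗ e_i)`. -/
theorem concat_letter_shuffleExp_commute {d : ℕ} (hd : 1 ≤ d) (l : Tensor d) (i : Fin d)
    (b : Tensor d) (c : Fin d → ℝ) (hb : b = ∑ j : Fin d, c j • letter j) :
    concatProd (concatProd l (letter i)) (shuffleExp b) =
      shuffle (shuffleExp b) (concatProd (shuffle (shuffleExp (-b)) l) (letter i)) := by
  subst hb
  rw [sum_letter, neg_mulPart, shuffleExp_mulPart, shuffleExp_mulPart]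
  funext w
  exact main_aux l i c w

end Sig
end
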